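/- The function log cosh is the Legendre transform of ψ: for every x ∈ ℝ, log (cosh x) = sup_{a ∈ [−1,1]} (a·x − ψ(a)), and the supremum is attained at a = tanh x. Conversely, for every a ∈ [−1,1], ψ(a) = sup_{x ∈ ℝ} (a·x − log (cosh x)). -/

import Mathlib

/-- `ψ(x) = (1/2)[(1+x) log(1+x) + (1-x) log(1-x)]`, with the convention `0 · log 0 = 0`
(automatic since `Real.log 0 = 0`). -/
noncomputable def psi (x : ℝ) : ℝ :=
  (1 / 2) * ((1 + x) * Real.log (1 + x) + (1 - x) * Real.log (1 - x))

open Real Set Filter Topology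

theorem continuous_psi : Continuous psi := by
  have h₁ : Continuous fun x : ℝ => (1 + x) * log (1 + x) :=
    continuous_mul_log.comp (continuous_const.add continuous_id)
  have h₂ : Continuous fun x : ℝ => (1 - x) * log (1 - x) :=
    continuous_mul_log.comp (continuous_const.sub continuous_id)
  exact continuous_const.mul (h₁.add h₂)

theorem mul_log_sub_mul_log_ge_sub {u v : ℝ} (hu : 0 ≤ u) (hv : 0 < v) :
    u - v ≤ u * log u - u * log v := by
  rcases hu.eq_or_lt with rfl | hu
  · simpa using hv.le
  · have h := mul_le_mul_of_nonneg_left (log_le_sub_one_of_pos (div_pos hv hu)) hu.le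
    rw [log_div hv.ne' hu.ne', mul_sub, mul_sub, mul_div_cancel₀ v hu.ne'] at h
    linarith

theorem one_add_tanh (x : ℝ) : 1 + tanh x = exp x / cosh x := by
  rw [tanh_eq_sinh_div_cosh, ← cosh_add_sinh, add_div, div_self (cosh_pos x).ne']

theorem one_sub_tanh (x : ℝ) : 1 - tanh x = exp (-x) / cosh x := by
  rw [tanh_eq_sinh_div_cosh, ← cosh_sub_sinh, sub_div, div_self (cosh_pos x).ne']

theorem log_one_add_tanh (x : ℝ) : log (1 + tanh x) = x - log (cosh x) := by
  rw [one_add_tanh, log_div (exp_pos x).ne' (cosh_pos x).ne', log_exp]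

theorem log_one_sub_tanh (x : ℝ) : log (1 - tanh x) = -x - log (cosh x) := by
  rw [one_sub_tanh, log_div (exp_pos (-x)).ne' (cosh_pos x).ne', log_exp]

theorem tanh_mul_sub_psi_tanh (x : ℝ) : tanh x * x - psi (tanh x) = log (cosh x) := by
  rw [psi, log_one_add_tanh, log_one_sub_tanh]
  ring

/-- The Fenchel–Young inequality for `psi` and `log cosh`. -/
theorem mul_le_psi_add_log_cosh {a : ℝ} (ha : a ∈ Icc (-1 : ℝ) 1) (x : ℝ) :
    a * x ≤ psi a + log (cosh x) := by
  have h₁ := mul_log_sub_mul_log_ge_sub (u := 1 + a) (v := 1 + tanh x)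
    (by linarith [ha.1]) (by linarith [neg_one_lt_tanh x])
  have h₂ := mul_log_sub_mul_log_ge_sub (u := 1 - a) (v := 1 - tanh x)
    (by linarith [ha.2]) (by linarith [tanh_lt_one x])
  rw [log_one_add_tanh] at h₁
  rw [log_one_sub_tanh] at h₂
  rw [psi]
  linarith

theorem psi_nonneg {a : ℝ} (ha : a ∈ Icc (-1 : ℝ) 1) : 0 ≤ psi a := by
  simpa using mul_le_psi_add_log_cosh ha 0

theorem exists_psi_mul_le {a s : ℝ} (ha : a ∈ Icc (-1 : ℝ) 1) (hs : s ∈ Ioo (0 : ℝ) 1) :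
    ∃ x, psi (s * a) ≤ a * x - log (cosh x) := by
  have hsa : s * a ∈ Ioo (-1 : ℝ) 1 := by
    constructor <;> nlinarith [ha.1, ha.2, hs.1, hs.2]
  obtain ⟨x, -, hx⟩ := tanh_surjOn hsa
  have h := tanh_mul_sub_psi_tanh x
  rw [hx] at h
  have hL : 0 ≤ log (cosh x) := log_nonneg (one_le_cosh x)
  have hψ := psi_nonneg (Ioo_subset_Icc_self hsa)
  have hax : 0 ≤ a * x := nonneg_of_mul_nonneg_right (a := s) (by linarith) hs.1
  exact ⟨x, by nlinarith [hs.2]⟩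

/-- `log cosh` is the Legendre transform of `ψ`: for every `x`,
`log cosh x = sup_{a ∈ [-1,1]} (a x - ψ(a))`, with the supremum attained at `a = tanh x`;
conversely, for every `a ∈ [-1,1]`, `ψ(a) = sup_{x ∈ ℝ} (a x - log cosh x)`. -/
theorem log_cosh_legendre_transform_psi :
    (∀ x : ℝ,
      IsGreatest ((fun a => a * x - psi a) '' Set.Icc (-1 : ℝ) 1)
        (Real.log (Real.cosh x)) ∧
      Real.tanh x ∈ Set.Icc (-1 : ℝ) 1 ∧
      Real.tanh x * x - psi (Real.tanh x) = Real.log (Real.cosh x)) ∧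
    (∀ a : ℝ, a ∈ Set.Icc (-1 : ℝ) 1 →
      IsLUB (Set.range (fun x : ℝ => a * x - Real.log (Real.cosh x))) (psi a)) := by
  refine ⟨fun x => ?_, fun a ha => ⟨?_, fun b hb => ?_⟩⟩
  · have hx : tanh x ∈ Icc (-1 : ℝ) 1 := ⟨(neg_one_lt_tanh x).le, (tanh_lt_one x).le⟩
    refine ⟨⟨⟨tanh x, hx, tanh_mul_sub_psi_tanh x⟩, ?_⟩, hx, tanh_mul_sub_psi_tanh x⟩
    rintro _ ⟨a, ha, rfl⟩
    linarith [mul_le_psi_add_log_cosh ha x]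
  · rintro _ ⟨x, rfl⟩
    linarith [mul_le_psi_add_log_cosh ha x]
  · have hlim : Tendsto (fun s : ℝ => psi (s * a)) (𝓝[<] 1) (𝓝 (psi a)) := by
      have hc : Continuous fun s : ℝ => psi (s * a) :=
        continuous_psi.comp (continuous_id.mul continuous_const)
      simpa using (hc.tendsto 1).mono_left nhdsWithin_le_nhds
    refine le_of_tendsto hlim ?_
    filter_upwards [Ioo_mem_nhdsLT (zero_lt_one (α := ℝ))] with s hs
    obtain ⟨x, hx⟩ := exists_psi_mul_le ha hs
    exact hx.trans (hb ⟨x, rfl⟩)
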